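/- arXiv:math/0611214 — 2 statements merged into one kernel-verified Lean document; each statement's English description precedes it below -/
import Mathlib

section
/- Let Q=[A,B,C] be a real binary quadratic form with discriminant D=B²−4AC>0, let s∈ℂ with Re s>1, let z∈ℍ, and let g∈SL(2,ℤ). Define F_Q(s,z) := Σ_{(c,d)} (φ(z,Q)/((cz+d)·(c·(N_Q·z)+d)))^s, the sum over coprime pairs (c,d)∈ℤ² with c>0 or (c=0 and d=1), with principal-branch powers. Then F_{gQ}(s, g·z) = F_Q(s,z). -/
open Complex

noncomputable section

/-- A real binary quadratic form `Q = [A,B,C]`, as a triple of coefficients. -/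
abbrev QF : Type := ℝ × ℝ × ℝ

/-- The value `Q(z) = A z² + B z + C`. -/
def Qpoly (Q : QF) (z : ℂ) : ℂ := (Q.1 : ℂ) * z ^ 2 + (Q.2.1 : ℂ) * z + (Q.2.2 : ℂ)

/-- The derivative `Q'(z) = 2 A z + B`. -/
def Qderiv (Q : QF) (z : ℂ) : ℂ := 2 * (Q.1 : ℂ) * z + (Q.2.1 : ℂ)

/-- `φ(z,Q) = Q(z)/Q'(z)`. -/
def phiQ (Q : QF) (z : ℂ) : ℂ := Qpoly Q z / Qderiv Q z

/-- The Möbius action of the matrix `N_Q = [[-B,-2C],[2A,B]]` on `z`. -/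
def NQmoeb (Q : QF) (z : ℂ) : ℂ :=
  (-(Q.2.1 : ℂ) * z - 2 * (Q.2.2 : ℂ)) / (2 * (Q.1 : ℂ) * z + (Q.2.1 : ℂ))

/-- The right action `Q|g` of `g = [[a,b],[c,d]]` on forms:
`(Q|g)(x,y) = Q(ax+by, cx+dy)`. -/
def Qslash (Q : QF) (a b c d : ℝ) : QF :=
  (Q.1 * a ^ 2 + Q.2.1 * a * c + Q.2.2 * c ^ 2,
   2 * Q.1 * a * b + Q.2.1 * (a * d + b * c) + 2 * Q.2.2 * c * d,
   Q.1 * b ^ 2 + Q.2.1 * b * d + Q.2.2 * d ^ 2)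

abbrev SL2Z := Matrix.SpecialLinearGroup (Fin 2) ℤ

/-- The left action `gQ := Q|g⁻¹`. -/
def QAct (g : SL2Z) (Q : QF) : QF :=
  Qslash Q (((g⁻¹).1 0 0 : ℤ) : ℝ) (((g⁻¹).1 0 1 : ℤ) : ℝ)
    (((g⁻¹).1 1 0 : ℤ) : ℝ) (((g⁻¹).1 1 1 : ℤ) : ℝ)

/-- The Möbius action `g·z = (az+b)/(cz+d)` of `g ∈ SL(2,ℤ)` on `z ∈ ℂ`. -/
def moebZ (g : SL2Z) (z : ℂ) : ℂ :=
  (((g.1 0 0 : ℤ) : ℂ) * z + ((g.1 0 1 : ℤ) : ℂ)) /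
    (((g.1 1 0 : ℤ) : ℂ) * z + ((g.1 1 1 : ℤ) : ℂ))

/-- The holomorphic lift of the Eisenstein series:
`F_Q(s,z) = Σ_{(c,d)} (φ(z,Q)/((cz+d)(c(N_Q·z)+d)))^s`, the sum over coprime
pairs `(c,d) ∈ ℤ²` with `c > 0` or `(c,d) = (0,1)`, principal-branch powers. -/
def FQ (Q : QF) (s z : ℂ) : ℂ :=
  ∑' p : {p : ℤ × ℤ // IsCoprime p.1 p.2 ∧ (0 < p.1 ∨ (p.1 = 0 ∧ p.2 = 1))},
    (phiQ Q z /
      (((p.1.1 : ℂ) * z + (p.1.2 : ℂ)) *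
        ((p.1.1 : ℂ) * NQmoeb Q z + (p.1.2 : ℂ)))) ^ s

/-- The index set of `FQ`. -/
abbrev CoprimeRep : Type :=
  {p : ℤ × ℤ // IsCoprime p.1 p.2 ∧ (0 < p.1 ∨ (p.1 = 0 ∧ p.2 = 1))}

/-- The base of the power in the term of `FQ` indexed by `p`. -/
def eisBase (Q : QF) (z : ℂ) (p : ℤ × ℤ) : ℂ :=
  phiQ Q z / (((p.1 : ℂ) * z + (p.2 : ℂ)) * ((p.1 : ℂ) * NQmoeb Q z + (p.2 : ℂ)))

lemma eisBase_neg (Q : QF) (z : ℂ) (p : ℤ × ℤ) : eisBase Q z (-p) = eisBase Q z p := by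
  unfold eisBase
  congr 1
  push_cast [Prod.fst_neg, Prod.snd_neg]
  ring

open Classical in
/-- The representative of `p` up to sign in the index set of `FQ`. -/
def signNormalize (p : ℤ × ℤ) : ℤ × ℤ :=
  if 0 < p.1 ∨ (p.1 = 0 ∧ p.2 = 1) then p else -p

lemma signNormalize_eq_or (p : ℤ × ℤ) : signNormalize p = p ∨ signNormalize p = -p := by
  unfold signNormalize
  split_ifs <;> simp

lemma isUnit_snd_of_fst_eq_zero {p : ℤ × ℤ} (hp : IsCoprime p.1 p.2) (h : p.1 = 0) :
    p.2 = 1 ∨ p.2 = -1 := by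
  rw [h, isCoprime_zero_left] at hp
  exact Int.isUnit_iff.mp hp

lemma signNormalize_mem {p : ℤ × ℤ} (hp : IsCoprime p.1 p.2) :
    IsCoprime (signNormalize p).1 (signNormalize p).2 ∧
      (0 < (signNormalize p).1 ∨ ((signNormalize p).1 = 0 ∧ (signNormalize p).2 = 1)) := by
  have hu := isUnit_snd_of_fst_eq_zero hp
  unfold signNormalize
  split_ifs with h
  · exact ⟨hp, h⟩
  · refine ⟨hp.neg_neg, ?_⟩
    simp only [Prod.fst_neg, Prod.snd_neg]
    lia

lemma signNormalize_neg {p : ℤ × ℤ} (hp : IsCoprime p.1 p.2) :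
    signNormalize (-p) = signNormalize p := by
  have hu := isUnit_snd_of_fst_eq_zero hp
  unfold signNormalize
  simp only [Prod.fst_neg, Prod.snd_neg]
  split_ifs with h h' h'
  · lia
  · rfl
  · simp
  · lia

lemma signNormalize_of_mem (p : CoprimeRep) : signNormalize p.1 = p.1 :=
  if_pos p.2.2

lemma eisBase_signNormalize (Q : QF) (z : ℂ) (p : ℤ × ℤ) :
    eisBase Q z (signNormalize p) = eisBase Q z p := by
  rcases signNormalize_eq_or p with h | h <;> rw [h]
  exact eisBase_neg Q z p

/-- The row vector `p` times the matrix `g`. -/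
def rowMul (g : SL2Z) (p : ℤ × ℤ) : ℤ × ℤ :=
  (p.1 * g.1 0 0 + p.2 * g.1 1 0, p.1 * g.1 0 1 + p.2 * g.1 1 1)

lemma rowMul_neg (g : SL2Z) (p : ℤ × ℤ) : rowMul g (-p) = -rowMul g p := by
  ext <;> simp [rowMul] <;> ring

lemma SL2Z.det_eq (g : SL2Z) : g.1 0 0 * g.1 1 1 - g.1 0 1 * g.1 1 0 = 1 := by
  rw [← Matrix.det_fin_two]
  exact g.2

lemma SL2Z.inv_entries (g : SL2Z) :
    (g⁻¹).1 0 0 = g.1 1 1 ∧ (g⁻¹).1 0 1 = -g.1 0 1 ∧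
      (g⁻¹).1 1 0 = -g.1 1 0 ∧ (g⁻¹).1 1 1 = g.1 0 0 := by
  simp [Matrix.SpecialLinearGroup.coe_inv, Matrix.adjugate_fin_two]

lemma rowMul_inv_rowMul (g : SL2Z) (p : ℤ × ℤ) : rowMul g⁻¹ (rowMul g p) = p := by
  obtain ⟨h00, h01, h10, h11⟩ := SL2Z.inv_entries g
  have hd := SL2Z.det_eq g
  ext
  · simp only [rowMul, h00, h01, h10, h11]
    linear_combination p.1 * hd
  · simp only [rowMul, h00, h01, h10, h11]
    linear_combination p.2 * hd

lemma isCoprime_rowMul (g : SL2Z) {p : ℤ × ℤ} (hp : IsCoprime p.1 p.2) :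
    IsCoprime (rowMul g p).1 (rowMul g p).2 := by
  obtain ⟨u, v, huv⟩ := hp
  have hd := SL2Z.det_eq g
  refine ⟨u * g.1 1 1 - v * g.1 0 1, v * g.1 0 0 - u * g.1 1 0, ?_⟩
  simp only [rowMul]
  linear_combination huv + (u * p.1 + v * p.2) * hd

/-- Right multiplication by `g` on the index set of `FQ`, up to sign. -/
def repMul (g : SL2Z) (p : CoprimeRep) : CoprimeRep :=
  ⟨signNormalize (rowMul g p.1), signNormalize_mem (isCoprime_rowMul g p.2.1)⟩

lemma repMul_inv_repMul (g : SL2Z) (p : CoprimeRep) : repMul g⁻¹ (repMul g p) = p := by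
  apply Subtype.ext
  simp only [repMul]
  rcases signNormalize_eq_or (rowMul g p.1) with h | h <;> rw [h]
  · rw [rowMul_inv_rowMul, signNormalize_of_mem]
  · rw [rowMul_neg, rowMul_inv_rowMul, signNormalize_neg p.2.1, signNormalize_of_mem]

/-- Right multiplication by `g`, up to sign, as a permutation of the index set of `FQ`. -/
def repEquiv (g : SL2Z) : CoprimeRep ≃ CoprimeRep where
  toFun := repMul g
  invFun := repMul g⁻¹
  left_inv := repMul_inv_repMul g
  right_inv p := by simpa using repMul_inv_repMul g⁻¹ p

lemma eq_zero_of_real_linear {z : ℂ} (hz : z.im ≠ 0) {p q : ℝ} (h : (p : ℂ) * z + q = 0) :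
    p = 0 ∧ q = 0 := by
  have him := congrArg Complex.im h
  have hre := congrArg Complex.re h
  simp only [add_im, mul_im, ofReal_re, ofReal_im, zero_mul, add_zero, zero_im, mul_eq_zero,
    hz, or_false] at him
  subst him
  simpa using hre

lemma eisBase_eq {Q : QF} {z : ℂ} (h : Qderiv Q z ≠ 0) (p : ℤ × ℤ) :
    eisBase Q z p = Qpoly Q z / (((p.1 : ℂ) * z + p.2) *
      (p.1 * (-(Q.2.1 : ℂ) * z - 2 * (Q.2.2 : ℂ)) + p.2 * Qderiv Q z)) := by
  have hN : (p.1 : ℂ) * NQmoeb Q z + p.2 =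
      (p.1 * (-(Q.2.1 : ℂ) * z - 2 * (Q.2.2 : ℂ)) + p.2 * Qderiv Q z) / Qderiv Q z := by
    rw [add_div, mul_div_cancel_right₀ _ h, mul_div_assoc]
    rfl
  rw [eisBase, hN, phiQ, mul_div_assoc', div_div_div_cancel_right₀ h]

lemma Qderiv_ne_zero {A B C : ℝ} (hD : 0 < B ^ 2 - 4 * A * C) {z : ℂ} (hz : z.im ≠ 0) :
    Qderiv (A, B, C) z ≠ 0 := by
  intro h
  obtain ⟨hA, hB⟩ := eq_zero_of_real_linear hz (p := 2 * A) (q := B) (by simpa [Qderiv] using h)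
  have hA' : A = 0 := by linarith
  simp [hA', hB] at hD

lemma moebZ_denom_ne_zero (g : SL2Z) {z : ℂ} (hz : z.im ≠ 0) :
    ((g.1 1 0 : ℤ) : ℂ) * z + ((g.1 1 1 : ℤ) : ℂ) ≠ 0 := by
  intro h
  obtain ⟨h0, h1⟩ := eq_zero_of_real_linear hz (p := (g.1 1 0 : ℤ)) (q := (g.1 1 1 : ℤ))
    (by simpa using h)
  have hd := SL2Z.det_eq g
  norm_cast at h0 h1
  simp [h0, h1] at hd

lemma moebZ_im_ne_zero (g : SL2Z) {z : ℂ} (hz : z.im ≠ 0) : (moebZ g z).im ≠ 0 := by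
  intro h
  have hj := moebZ_denom_ne_zero g hz
  have hw : moebZ g z = ((moebZ g z).re : ℂ) := by
    apply Complex.ext <;> simp [h]
  set r := (moebZ g z).re
  rw [moebZ, div_eq_iff hj] at hw
  obtain ⟨h0, h1⟩ := eq_zero_of_real_linear hz
    (p := (g.1 0 0 : ℤ) - r * (g.1 1 0 : ℤ)) (q := (g.1 0 1 : ℤ) - r * (g.1 1 1 : ℤ))
    (by push_cast; linear_combination hw)
  have hd : ((g.1 0 0 : ℤ) : ℝ) * (g.1 1 1 : ℤ) - (g.1 0 1 : ℤ) * (g.1 1 0 : ℤ) = 1 := by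
    exact_mod_cast SL2Z.det_eq g
  have : (0 : ℝ) = 1 := by linear_combination hd - (g.1 1 1 : ℤ) * h0 + (g.1 1 0 : ℤ) * h1
  exact zero_ne_one this

/-- The terms of `FQ` are permuted by `SL(2,ℤ)` without changing the base of the power. -/
lemma eisBase_QAct (A B C : ℝ) (hD : 0 < B ^ 2 - 4 * A * C) {z : ℂ} (hz : z.im ≠ 0) (g : SL2Z)
    (p : ℤ × ℤ) :
    eisBase (QAct g (A, B, C)) (moebZ g z) p = eisBase (A, B, C) z (rowMul g p) := by
  have hj := moebZ_denom_ne_zero g hz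
  have hw := moebZ_im_ne_zero g hz
  have hdZ := SL2Z.det_eq g
  obtain ⟨h00, h01, h10, h11⟩ := SL2Z.inv_entries g
  have hQ' : Qderiv (QAct g (A, B, C)) (moebZ g z) ≠ 0 := by
    refine Qderiv_ne_zero ?_ hw
    have hd : ((g.1 0 0 : ℤ) : ℝ) * (g.1 1 1 : ℤ) - (g.1 0 1 : ℤ) * (g.1 1 0 : ℤ) = 1 := by
      exact_mod_cast hdZ
    rw [h00, h01, h10, h11]
    push_cast
    generalize ((g.1 0 0 : ℤ) : ℝ) = α at *
    generalize ((g.1 0 1 : ℤ) : ℝ) = β at *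
    generalize ((g.1 1 0 : ℤ) : ℝ) = γ at *
    generalize ((g.1 1 1 : ℤ) : ℝ) = δ at *
    have : (B ^ 2 - 4 * A * C) * (α * δ - β * γ) ^ 2 > 0 := by rw [hd]; linarith
    linarith
  rw [eisBase_eq hQ', eisBase_eq (Qderiv_ne_zero hD hz)]
  have hd : ((g.1 0 0 : ℤ) : ℂ) * (g.1 1 1 : ℤ) - (g.1 0 1 : ℤ) * (g.1 1 0 : ℤ) = 1 := by
    exact_mod_cast hdZ
  simp only [QAct, Qslash, Qpoly, Qderiv, rowMul, moebZ, h00, h01, h10, h11] at hj ⊢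
  push_cast
  clear hQ' hw hdZ h00 h01 h10 h11
  generalize ((g.1 0 0 : ℤ) : ℂ) = α at *
  generalize ((g.1 0 1 : ℤ) : ℂ) = β at *
  generalize ((g.1 1 0 : ℤ) : ℂ) = γ at *
  generalize ((g.1 1 1 : ℤ) : ℂ) = δ at *
  generalize (p.1 : ℂ) = c
  generalize (p.2 : ℂ) = d
  generalize (A : ℂ) = a
  generalize (B : ℂ) = b
  generalize (C : ℂ) = e
  set j := γ * z + δ with hjdef
  have hj2 : j ^ 2 ≠ 0 := pow_ne_zero 2 hj
  conv_rhs => rw [← div_div_div_cancel_right₀ hj2]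
  congr 1
  · field_simp
    rw [hjdef]
    linear_combination (a * z ^ 2 + b * z + e) * (α * δ - β * γ + 1) * hd
  · have hx : c * ((α * z + β) / j) + d = ((c * α + d * γ) * z + (c * β + d * δ)) / j := by
      field_simp
      rw [hjdef]
      ring
    rw [hx, pow_two j, mul_div_mul_comm]
    congr 1
    field_simp
    rw [hjdef]
    linear_combination ((c * α + d * γ) * (-b * z - 2 * e) + (c * β + d * δ) * (2 * a * z + b)) * hd

/-- Let `Q = [A,B,C]` have discriminant `B² - 4AC > 0`, let
`Re s > 1`, `z ∈ ℍ`, and `g ∈ SL(2,ℤ)`.  Then `F_{gQ}(s, g·z) = F_Q(s,z)`. -/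
theorem FQ_invariant (A B C : ℝ) (hD : 0 < B ^ 2 - 4 * A * C)
    (s : ℂ) (hs : 1 < s.re) (z : ℂ) (hz : 0 < z.im) (g : SL2Z) :
    FQ (QAct g (A, B, C)) s (moebZ g z) = FQ (A, B, C) s z := by
  unfold FQ
  refine Eq.trans (tsum_congr fun p => ?_)
    ((repEquiv g).tsum_eq fun p : CoprimeRep => eisBase (A, B, C) z p.1 ^ s)
  change eisBase _ _ p.1 ^ s = eisBase _ z (signNormalize (rowMul g p.1)) ^ s
  rw [eisBase_signNormalize, eisBase_QAct A B C hD hz.ne' g]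
end
end

section
/- Let D>0 be a nonsquare integer and let Q₀,Q₁,…,Q_r be integral binary quadratic forms of discriminant D with Q_r=Q₀, such that each Q_j is reduced in the sense that its leading coefficient A_j is positive and its roots x_j>x_j' satisfy 0<x_j'<1<x_j, and such that Q_j = Q_{j−1}|M_j with M_j = [[m_j,−1],[1,0]], m_j≥2 an integer, for j=1,…,r. Suppose M₁·M₂⋯M_r = (v/2)·I + (u/2)·N_{Q₀} for positive integers v,u with v²−D·u²=4, and set ε := (v+u√D)/2. Then ε² = Π_{j=0}^{r−1} x_j/x_j'. -/
open Complex

noncomputable section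

/-- An integral binary quadratic form `Q = [A,B,C]`, as a triple of integer
coefficients. -/
abbrev ZQF : Type := ℤ × ℤ × ℤ

/-- The right action `Q|g` of the integer matrix `g = [[a,b],[c,d]]` on
integral forms: `(Q|g)(x,y) = Q(ax+by, cx+dy)`. -/
def QslashZ (Q : ZQF) (a b c d : ℤ) : ZQF :=
  (Q.1 * a ^ 2 + Q.2.1 * a * c + Q.2.2 * c ^ 2,
   2 * Q.1 * a * b + Q.2.1 * (a * d + b * c) + 2 * Q.2.2 * c * d,
   Q.1 * b ^ 2 + Q.2.1 * b * d + Q.2.2 * d ^ 2)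

/-- The matrix `N_Q = [[-B,-2C],[2A,B]]` (with real entries). -/
def NQ (Q : ZQF) : Matrix (Fin 2) (Fin 2) ℝ :=
  !![-(Q.2.1 : ℝ), -2 * (Q.2.2 : ℝ); 2 * (Q.1 : ℝ), (Q.2.1 : ℝ)]

open Matrix in
/-- If `y j = m (j+1) - 1 / y (j+1)`, then the vector `(y r, 1)` is carried by the product of the
matrices `[[m j, -1], [1, 0]]` to a multiple of `(y 0, 1)`. -/
theorem prod_mulVec_of_step (r : ℕ) (m : ℕ → ℤ) (y : ℕ → ℝ)
    (h : ∀ j < r, (m (j + 1) : ℝ) * y (j + 1) - 1 = y j * y (j + 1)) :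
    (((List.range r).map fun j =>
        (!![(m (j + 1) : ℝ), -1; 1, 0] : Matrix (Fin 2) (Fin 2) ℝ)).prod) *ᵥ ![y r, 1] =
      (∏ j ∈ Finset.range r, y (j + 1)) • ![y 0, 1] := by
  induction r with
  | zero => simp
  | succ r ih =>
    have key : (!![(m (r + 1) : ℝ), -1; 1, 0] : Matrix (Fin 2) (Fin 2) ℝ) *ᵥ ![y (r + 1), 1] =
        y (r + 1) • ![y r, 1] := by
      have := h r r.lt_succ_self
      ext i
      fin_cases i
      · simp [Matrix.mulVec, dotProduct, Fin.sum_univ_two]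
        linarith
      · simp [Matrix.mulVec, dotProduct, Fin.sum_univ_two]
    rw [List.range_succ, List.map_append, List.prod_append, ← Matrix.mulVec_mulVec]
    simp only [List.map_cons, List.map_nil, List.prod_cons, List.prod_nil, mul_one]
    rw [key, Matrix.mulVec_smul, ih fun j hj => h j (hj.trans r.lt_succ_self), smul_smul,
      Finset.prod_range_succ, mul_comm]

/-- If `y` satisfies `y j = m (j+1) - 1 / y (j+1)` with `y r = y 0`, and the product of the matrices is
`(v/2) I + (u/2) N_Q`, then its eigenvalue `∏ y j` is `(v + u (2 A y₀ + B)) / 2`. -/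
theorem prod_eq_of_step (r : ℕ) (m : ℕ → ℤ) (y : ℕ → ℝ) (Q : ZQF) (v u : ℝ)
    (h : ∀ j < r, (m (j + 1) : ℝ) * y (j + 1) - 1 = y j * y (j + 1)) (hy : y r = y 0)
    (hy0 : y 0 ≠ 0)
    (hprod : (((List.range r).map fun j =>
        (!![(m (j + 1) : ℝ), -1; 1, 0] : Matrix (Fin 2) (Fin 2) ℝ)).prod) =
      (v / 2) • (1 : Matrix (Fin 2) (Fin 2) ℝ) + (u / 2) • NQ Q) :
    ∏ j ∈ Finset.range r, y j = (v + u * (2 * Q.1 * y 0 + Q.2.1)) / 2 := by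
  have hshift : ∏ j ∈ Finset.range r, y j = ∏ j ∈ Finset.range r, y (j + 1) := by
    have h1 := Finset.prod_range_succ y r
    rw [Finset.prod_range_succ', hy] at h1
    exact (mul_right_cancel₀ hy0 h1).symm
  have h2 := congrFun (prod_mulVec_of_step r m y h) 1
  rw [hprod, hy] at h2
  simp [NQ, Matrix.mulVec, dotProduct, Fin.sum_univ_two] at h2
  rw [hshift, ← h2]
  ring

/-- Vieta's formulas for a quadratic polynomial with two distinct roots. -/
theorem vieta_of_ne {A B C x x' : ℝ} (hx : A * x ^ 2 + B * x + C = 0)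
    (hx' : A * x' ^ 2 + B * x' + C = 0) (hne : x ≠ x') :
    B = -(A * (x + x')) ∧ C = A * (x * x') := by
  have hB : B = -(A * (x + x')) := by
    apply mul_left_cancel₀ (sub_ne_zero.2 hne)
    linear_combination hx - hx'
  exact ⟨hB, by rw [hB] at hx; linear_combination hx⟩

/-- The matrix `[[m, -1], [1, 0]]` carries the roots `z > z'` of `Q|M` to the roots `x > x'`
of `Q`. -/
theorem root_step {A B C m x x' z z' : ℝ} (hA : A ≠ 0) (hm : 2 ≤ m)
    (hx : A * x ^ 2 + B * x + C = 0) (hx' : A * x' ^ 2 + B * x' + C = 0)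
    (hx'1 : x' < 1) (hx1 : 1 < x) (hz'1 : z' < 1) (hz1 : 1 < z)
    (hz : (A * m ^ 2 + B * m + C) * z ^ 2 + (-2 * A * m - B) * z + A = 0)
    (hz' : (A * m ^ 2 + B * m + C) * z' ^ 2 + (-2 * A * m - B) * z' + A = 0) :
    m * z - 1 = x * z ∧ m * z' - 1 = x' * z' := by
  obtain ⟨rfl, rfl⟩ := vieta_of_ne hx hx' (hx'1.trans hx1).ne'
  have fac : ∀ w : ℝ, (A * m ^ 2 + -(A * (x + x')) * m + A * (x * x')) * w ^ 2 +
      (-2 * A * m - -(A * (x + x'))) * w + A = 0 →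
      m * w - 1 = x * w ∨ m * w - 1 = x' * w := by
    intro w hw
    have : (m * w - 1 - x * w) * (m * w - 1 - x' * w) = 0 := by
      apply mul_left_cancel₀ hA
      linear_combination hw
    exact (mul_eq_zero.1 this).imp sub_eq_zero.1 sub_eq_zero.1
  have h1 : m * z - 1 = x * z := (fac z hz).resolve_right fun h => by nlinarith
  refine ⟨h1, (fac z' hz').resolve_left fun h => ?_⟩
  have h2 : (m - x) * (z - z') = 0 := by linear_combination h1 - h
  rcases mul_eq_zero.1 h2 with h3 | h3
  · have : (m - x) * z = 1 := by linear_combination h1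
    simp [h3] at this
  · linarith

/-- Let `D > 0` be a nonsquare integer and
`Q₀, Q₁, …, Q_r` integral forms of discriminant `D` with `Q_r = Q₀`, each
reduced (`A_j > 0` and the roots satisfy `0 < x_j' < 1 < x_j`), and
`Q_j = Q_{j-1}|M_j` with `M_j = [[m_j,−1],[1,0]]`, `m_j ≥ 2`.  If
`M₁⋯M_r = (v/2)·I + (u/2)·N_{Q₀}` for positive integers `v, u` with
`v² − D·u² = 4`, then `ε := (v+u√D)/2` satisfies
`ε² = Π_{j=0}^{r-1} x_j/x_j'`. -/
theorem unit_squared_eq_prod_roots (D : ℤ) (hD : 0 < D) (hsq : ¬IsSquare D)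
    (r : ℕ) (Qs : ℕ → ZQF) (x x' : ℕ → ℝ) (m : ℕ → ℤ)
    (hdisc : ∀ j ≤ r, (Qs j).2.1 ^ 2 - 4 * (Qs j).1 * (Qs j).2.2 = D)
    (hcycle : Qs r = Qs 0)
    (hApos : ∀ j ≤ r, 0 < (Qs j).1)
    (hrootx : ∀ j ≤ r,
      ((Qs j).1 : ℝ) * x j ^ 2 + ((Qs j).2.1 : ℝ) * x j + ((Qs j).2.2 : ℝ) = 0)
    (hrootx' : ∀ j ≤ r,
      ((Qs j).1 : ℝ) * x' j ^ 2 + ((Qs j).2.1 : ℝ) * x' j + ((Qs j).2.2 : ℝ) = 0)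
    (hreduced : ∀ j ≤ r, 0 < x' j ∧ x' j < 1 ∧ 1 < x j)
    (hm : ∀ j, 1 ≤ j → j ≤ r → 2 ≤ m j)
    (hstep : ∀ j, 1 ≤ j → j ≤ r → Qs j = QslashZ (Qs (j - 1)) (m j) (-1) 1 0)
    (v u : ℤ) (hv : 0 < v) (hu : 0 < u) (hPell : v ^ 2 - D * u ^ 2 = 4)
    (hprod : (((List.range r).map fun j =>
        (!![(m (j + 1) : ℝ), -1; 1, 0] : Matrix (Fin 2) (Fin 2) ℝ)).prod) =
      ((v : ℝ) / 2) • (1 : Matrix (Fin 2) (Fin 2) ℝ) + ((u : ℝ) / 2) • NQ (Qs 0)) :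
    (((v : ℝ) + (u : ℝ) * Real.sqrt (D : ℝ)) / 2) ^ 2 =
      ∏ j ∈ Finset.range r, x j / x' j := by
  have hA : ∀ j ≤ r, (0 : ℝ) < (Qs j).1 := fun j hj => by exact_mod_cast hApos j hj
  have step : ∀ j < r, (m (j + 1) : ℝ) * x (j + 1) - 1 = x j * x (j + 1) ∧
      (m (j + 1) : ℝ) * x' (j + 1) - 1 = x' j * x' (j + 1) := by
    intro j hj
    obtain ⟨-, h1, h2⟩ := hreduced j hj.le
    obtain ⟨-, h3, h4⟩ := hreduced (j + 1) hj
    have hz := hrootx (j + 1) hj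
    have hz' := hrootx' (j + 1) hj
    rw [hstep (j + 1) (by omega) hj] at hz hz'
    simp only [QslashZ, Nat.add_sub_cancel] at hz hz'
    push_cast at hz hz'
    exact root_step (hA j hj.le).ne' (by exact_mod_cast hm (j + 1) (by omega) hj)
      (hrootx j hj.le) (hrootx' j hj.le) h1 h2 h3 h4
      (by linear_combination hz) (by linear_combination hz')
  obtain ⟨hpos, hlt, hgt⟩ := hreduced 0 r.zero_le
  obtain ⟨hposr, hltr, hgtr⟩ := hreduced r le_rfl
  have hA0 := hA 0 r.zero_le
  have hx0 := hrootx 0 r.zero_le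
  have hx0' := hrootx' 0 r.zero_le
  obtain ⟨hB, hC⟩ := vieta_of_ne hx0 hx0' (hlt.trans hgt).ne'
  have hxr := hrootx r le_rfl
  have hxr' := hrootx' r le_rfl
  rw [hcycle, hB, hC] at hxr hxr'
  have hfix : x r = x 0 := by
    have : ((Qs 0).1 * (x r - x' 0)) * (x r - x 0) = 0 := by linear_combination hxr
    have hne : ((Qs 0).1 : ℝ) * (x r - x' 0) ≠ 0 := mul_ne_zero hA0.ne' (by linarith)
    exact sub_eq_zero.1 ((mul_eq_zero.1 this).resolve_left hne)
  have hfix' : x' r = x' 0 := by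
    have : ((Qs 0).1 * (x' r - x 0)) * (x' r - x' 0) = 0 := by linear_combination hxr'
    have hne : ((Qs 0).1 : ℝ) * (x' r - x 0) ≠ 0 := mul_ne_zero hA0.ne' (by linarith)
    exact sub_eq_zero.1 ((mul_eq_zero.1 this).resolve_left hne)
  have hDR : ((Qs 0).2.1 : ℝ) ^ 2 - 4 * (Qs 0).1 * (Qs 0).2.2 = D := by
    exact_mod_cast hdisc 0 r.zero_le
  have hsqrt : Real.sqrt D = (Qs 0).1 * (x 0 - x' 0) := by
    rw [← hDR, hB, hC, ← Real.sqrt_sq (mul_nonneg hA0.le (by linarith : (0 : ℝ) ≤ x 0 - x' 0))]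
    congr 1
    ring
  have hP := prod_eq_of_step r m x (Qs 0) v u (fun j hj => (step j hj).1) hfix (by linarith) hprod
  have hP' := prod_eq_of_step r m x' (Qs 0) v u (fun j hj => (step j hj).2) hfix' hpos.ne' hprod
  rw [show 2 * ((Qs 0).1 : ℝ) * x 0 + (Qs 0).2.1 = Real.sqrt D by rw [hsqrt, hB]; ring] at hP
  rw [show 2 * ((Qs 0).1 : ℝ) * x' 0 + (Qs 0).2.1 = -Real.sqrt D by rw [hsqrt, hB]; ring] at hP'
  have hne : ∏ j ∈ Finset.range r, x' j ≠ 0 :=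
    Finset.prod_ne_zero_iff.2 fun j hj => (hreduced j (Finset.mem_range.1 hj).le).1.ne'
  have hunit : (∏ j ∈ Finset.range r, x j) * ∏ j ∈ Finset.range r, x' j = 1 := by
    have hs : Real.sqrt D ^ 2 = D := Real.sq_sqrt (by exact_mod_cast hD.le)
    have hp : (v : ℝ) ^ 2 - D * u ^ 2 = 4 := by exact_mod_cast hPell
    rw [hP, hP']
    linear_combination hp / 4 - u ^ 2 / 4 * hs
  rw [Finset.prod_div_distrib, ← hP, eq_div_iff hne]
  linear_combination (∏ j ∈ Finset.range r, x j) * hunit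
end
end
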